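/- arXiv:1101.1468 — 6 statements merged into one kernel-verified Lean document; each statement's English description precedes it below -/
import Mathlib

section
/- Let R be a commutative ring and A a separable R-algebra which is projective as an R-module. Then A is finitely generated as an R-module. -/
open TensorProduct MulOpposite

/-- A separable algebra has a separability idempotent, here written as a finite sum of tensors. -/
theorem exists_separability_element
    (R A : Type*) [CommRing R] [Ring A] [Algebra R A]
    (hsep : letI : Module (A ⊗[R] Aᵐᵒᵖ) A := TensorProduct.Algebra.module;
      Module.Projective (A ⊗[R] Aᵐᵒᵖ) A) :
    ∃ S : Finset (A × Aᵐᵒᵖ), ∑ p ∈ S, p.1 * p.2.unop = 1 ∧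
      ∀ a : A, ∑ p ∈ S, (a * p.1) ⊗ₜ[R] p.2 = ∑ p ∈ S, p.1 ⊗ₜ[R] (op a * p.2) := by
  let _ : Module (A ⊗[R] Aᵐᵒᵖ) A := TensorProduct.Algebra.module
  have hsmul (a : A) (b : Aᵐᵒᵖ) (x : A) : (a ⊗ₜ[R] b) • x = a * (x * b.unop) := by
    rw [TensorProduct.Algebra.smul_def]; rfl
  have : Module.Projective (A ⊗[R] Aᵐᵒᵖ) A := hsep
  obtain ⟨σ, hσ⟩ := LinearMap.exists_rightInverse_of_surjective
    (LinearMap.toSpanSingleton (A ⊗[R] Aᵐᵒᵖ) A 1)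
    (LinearMap.range_eq_top.2 fun a => ⟨a ⊗ₜ 1, by
      rw [LinearMap.toSpanSingleton_apply, hsmul]; simp⟩)
  obtain ⟨S, hS⟩ := TensorProduct.exists_finset (σ 1)
  refine ⟨S, ?_, fun a => ?_⟩
  · have h := LinearMap.congr_fun hσ 1
    rw [LinearMap.comp_apply, LinearMap.toSpanSingleton_apply, hS, Finset.sum_smul] at h
    simpa only [hsmul, one_mul, LinearMap.id_apply] using h
  · have h : (a ⊗ₜ[R] (1 : Aᵐᵒᵖ)) • σ 1 = ((1 : A) ⊗ₜ[R] op a) • σ 1 := by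
      rw [← map_smul, ← map_smul, hsmul, hsmul]; simp
    simpa [hS, Finset.mul_sum, Algebra.TensorProduct.tmul_mul_tmul] using h

/-- A separable `R`-algebra (i.e. one which is projective as a left module over its
enveloping algebra `Aᵉ = A ⊗[R] Aᵐᵒᵖ`) which is projective as an `R`-module is
finitely generated as an `R`-module. -/
theorem finite_of_separable_of_projective
    (R A : Type*) [CommRing R] [Ring A] [Algebra R A]
    [Module.Projective R A]
    (hsep : letI : Module (A ⊗[R] Aᵐᵒᵖ) A := TensorProduct.Algebra.module;
      Module.Projective (A ⊗[R] Aᵐᵒᵖ) A) :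
    Module.Finite R A := by
  classical
  obtain ⟨S, hS, hcomm⟩ := exists_separability_element R A hsep
  obtain ⟨s, hs⟩ := Module.projective_def.1 ‹Module.Projective R A›
  let F : Finset A := S.biUnion fun p => (s p.1).support
  have hvanish (a i : A) (hi : i ∉ F) : ∑ p ∈ S, s (a * p.1) i • p.2.unop = 0 := by
    let g : A ⊗[R] Aᵐᵒᵖ →ₗ[R] A := TensorProduct.lift
      ((LinearMap.lsmul R A).compl₂ (opLinearEquiv R).symm.toLinearMap ∘ₗ Finsupp.lapply i ∘ₗ s)
    have hg (x : A) (y : Aᵐᵒᵖ) : g (x ⊗ₜ y) = s x i • y.unop := rfl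
    have h := congrArg g (hcomm a)
    simp only [map_sum, hg] at h
    rw [h]
    refine Finset.sum_eq_zero fun p hp => ?_
    have : s p.1 i = 0 := by
      by_contra hne
      exact hi (Finset.mem_biUnion.2 ⟨p, hp, Finsupp.mem_support_iff.2 hne⟩)
    rw [this, zero_smul]
  refine ⟨⟨(F ×ˢ S).image fun q => q.1 * q.2.2.unop, eq_top_iff.2 fun a _ => ?_⟩⟩
  let G : Finset A := F ∪ S.biUnion fun p => (s (a * p.1)).support
  have hexp (p) (hp : p ∈ S) : a * p.1 = ∑ i ∈ G, s (a * p.1) i • i := by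
    conv_lhs => rw [← hs (a * p.1)]
    rw [Finsupp.linearCombination_apply, Finsupp.sum_of_support_subset (s := G)]
    · rfl
    · exact (Finset.subset_biUnion_of_mem (fun p : A × Aᵐᵒᵖ => (s (a * p.1)).support) hp).trans
        Finset.subset_union_right
    · simp
  have key : a = ∑ i ∈ F, ∑ p ∈ S, s (a * p.1) i • (i * p.2.unop) := calc
    a = ∑ p ∈ S, (a * p.1) * p.2.unop := by
      simp only [mul_assoc, ← Finset.mul_sum, hS, mul_one]
    _ = ∑ p ∈ S, ∑ i ∈ G, s (a * p.1) i • (i * p.2.unop) :=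
      Finset.sum_congr rfl fun p hp => by
        conv_lhs => rw [hexp p hp]
        simp only [Finset.sum_mul, smul_mul_assoc]
    _ = ∑ i ∈ G, ∑ p ∈ S, s (a * p.1) i • (i * p.2.unop) := Finset.sum_comm
    _ = _ := by
      refine (Finset.sum_subset Finset.subset_union_left fun i _ hi => ?_).symm
      simp only [← mul_smul_comm, ← Finset.mul_sum, hvanish a i hi, mul_zero]
  rw [key]
  refine Submodule.sum_mem _ fun i hi => Submodule.sum_mem _ fun p hp =>
    Submodule.smul_mem _ _ (Submodule.subset_span ?_)
  exact Finset.mem_coe.2 (Finset.mem_image.2 ⟨(i, p), Finset.mem_product.2 ⟨hi, hp⟩, rfl⟩)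
end

section
/- Let D be a graded division ring graded by an abelian group Γ. If every homogeneous additive commutator ab − ba (with a, b homogeneous elements of D) lies in the centre of D, then D is commutative, i.e. D is a graded field. -/
/-- Let `D` be a graded division ring graded by an abelian group `Γ` (every nonzero
homogeneous element is invertible).  If every homogeneous additive commutator `a*b - b*a`
(with `a`, `b` homogeneous) lies in the centre of `D`, then `D` is commutative, i.e. `D` is
a graded field. -/
theorem commutative_of_homogeneous_commutators_central
    (Γ D : Type*) [AddCommGroup Γ] [DecidableEq Γ] [Ring D]
    (𝒜 : Γ → AddSubgroup D) [GradedRing 𝒜]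
    (hdiv : ∀ (γ : Γ) (x : D), x ∈ 𝒜 γ → x ≠ 0 → IsUnit x)
    (hcomm : ∀ (γ δ : Γ) (a b : D), a ∈ 𝒜 γ → b ∈ 𝒜 δ →
      a * b - b * a ∈ Subring.center D) :
    ∀ x y : D, x * y = y * x := by
  have homogeneous_comm : ∀ (γ δ : Γ) (a b : D), a ∈ 𝒜 γ → b ∈ 𝒜 δ → a * b = b * a := by
    intro γ δ a b ha hb
    by_contra hne
    have hab : a * b ∈ 𝒜 (γ + δ) := SetLike.mul_mem_graded ha hb
    have hba : b * a ∈ 𝒜 (γ + δ) := add_comm δ γ ▸ SetLike.mul_mem_graded hb ha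
    have hunit : IsUnit (a * b - b * a) :=
      hdiv _ _ (sub_mem hab hba) (sub_ne_zero.mpr hne)
    have hc := Subring.mem_center_iff.mp (hcomm _ _ a b ha hb) b
    have hac := Subring.mem_center_iff.mp (hcomm _ _ a (a * b) ha hab) b
    have hsq : (a * b - b * a) * (a * b - b * a) = 0 := by
      have h₁ : a * (a * b) - a * b * a = a * (a * b - b * a) := by noncomm_ring
      rw [h₁] at hac
      calc (a * b - b * a) * (a * b - b * a)
          = a * (b * (a * b - b * a)) - b * (a * (a * b - b * a)) := by noncomm_ring
        _ = 0 := by rw [hc, hac]; noncomm_ring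
    exact hne (sub_eq_zero.mp (hunit.mul_left_eq_zero.mp hsq))
  intro x y
  induction x using DirectSum.Decomposition.inductionOn 𝒜 with
  | zero => simp
  | add x₁ x₂ h₁ h₂ => rw [add_mul, mul_add, h₁, h₂]
  | homogeneous a =>
    induction y using DirectSum.Decomposition.inductionOn 𝒜 with
    | zero => simp
    | add y₁ y₂ h₁ h₂ => rw [add_mul, mul_add, h₁, h₂]
    | homogeneous b => exact homogeneous_comm _ _ _ _ a.2 b.2
end

section
/- Let D be a graded division ring graded by an abelian group Γ, with centre F. If E is a graded division subring of D containing F (i.e. E is a subring of D containing F which is closed under taking homogeneous components and under inverses of its nonzero homogeneous elements) such that E contains every homogeneous additive commutator ab − ba with a, b homogeneous in D, then E = D. That is, the smallest graded division subring of D over F containing all homogeneous additive commutators is D itself. -/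
/-- An element that commutes with every homogeneous element is central. -/
theorem Subring.mem_center_of_forall_homogeneous_commute {Γ D : Type*} [AddCommGroup Γ]
    [DecidableEq Γ] [Ring D] (𝒜 : Γ → AddSubgroup D) [GradedRing 𝒜] {a : D}
    (h : ∀ (δ : Γ) (b : D), b ∈ 𝒜 δ → a * b = b * a) : a ∈ Subring.center D := by
  rw [Subring.mem_center_iff]
  intro x
  induction x using DirectSum.Decomposition.inductionOn 𝒜 with
  | zero => simp
  | homogeneous b => exact (h _ b b.2).symm
  | add x y hx hy => rw [add_mul, mul_add, hx, hy]


/-- Let `D` be a graded division ring graded by an abelian group `Γ`, with centre `F`.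
If `E` is a graded division subring of `D` containing `F` (a subring containing the centre,
closed under homogeneous components and under inverses of its nonzero homogeneous elements)
which contains every homogeneous additive commutator `a*b - b*a`, then `E = D`: the smallest
graded division subring of `D` over `F` containing all homogeneous additive commutators is
`D` itself. -/
theorem gradedDivisionSubring_generated_by_commutators
    (Γ D : Type*) [AddCommGroup Γ] [DecidableEq Γ] [Ring D]
    (𝒜 : Γ → AddSubgroup D) [GradedRing 𝒜]
    (hdiv : ∀ (γ : Γ) (x : D), x ∈ 𝒜 γ → x ≠ 0 → IsUnit x)
    (E : Subring D)
    (hcenter : Subring.center D ≤ E)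
    (hcomp : ∀ x ∈ E, ∀ γ : Γ, (DirectSum.decompose 𝒜 x γ : D) ∈ E)
    (hinv : ∀ x y : D, x ∈ E → (∃ γ, x ∈ 𝒜 γ) → x * y = 1 → y * x = 1 → y ∈ E)
    (hcommutators : ∀ (γ δ : Γ) (a b : D), a ∈ 𝒜 γ → b ∈ 𝒜 δ → a * b - b * a ∈ E) :
    E = ⊤ := by
  have hom : ∀ (γ : Γ) (a : D), a ∈ 𝒜 γ → a ∈ E := by
    intro γ a ha
    by_cases h : ∀ (δ : Γ) (b : D), b ∈ 𝒜 δ → a * b = b * a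
    · exact hcenter (Subring.mem_center_of_forall_homogeneous_commute 𝒜 h)
    push Not at h
    obtain ⟨δ, b, hb, hab⟩ := h
    have hcE : a * b - b * a ∈ E := hcommutators γ δ a b ha hb
    have hc : a * b - b * a ∈ 𝒜 (γ + δ) :=
      sub_mem (SetLike.mul_mem_graded ha hb) (add_comm δ γ ▸ SetLike.mul_mem_graded hb ha)
    have hacE : a * (a * b - b * a) ∈ E := by
      have := hcommutators γ (γ + δ) a (a * b) ha (SetLike.mul_mem_graded ha hb)
      rwa [mul_assoc, ← mul_sub] at this
    obtain ⟨d, hcd, hdc⟩ :=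
      isUnit_iff_exists.mp (hdiv (γ + δ) _ hc (sub_ne_zero.mpr hab))
    have hdE : d ∈ E := hinv _ d hcE ⟨_, hc⟩ hcd hdc
    simpa [mul_assoc, hcd] using E.mul_mem hacE hdE
  classical
  rw [eq_top_iff]
  intro x _
  rw [← DirectSum.sum_support_decompose 𝒜 x]
  exact sum_mem fun γ _ => hom γ _ (SetLike.coe_mem _)
end

section
/- Let D be a graded division algebra (graded by an abelian group Γ) over its centre F, and let [D,D] be the F-submodule of D generated by all homogeneous additive commutators ab − ba with a, b homogeneous. Write Supp(N) = {γ ∈ Γ : N ∩ D_γ ≠ 0} for a graded submodule N, and D₀, F₀ for the degree-0 components. Then: (1) if D is totally ramified (D₀ = F₀) then 0 ∉ Supp([D,D]); in particular if moreover D is noncommutative then ∅ ≠ Supp([D,D]) ⊊ Supp(D); and (2) if D is not totally ramified then Supp([D,D]) = Supp(D). -/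
variable {Γ D : Type*} [AddCommGroup Γ] [DecidableEq Γ] [Ring D]

/-- `[D,D]`: the submodule of `D` over its centre generated by the homogeneous additive
commutators `a*b - b*a` (`a`, `b` homogeneous). -/
def homCommutatorSubmodule (𝒜 : Γ → AddSubgroup D) : Submodule (Subring.center D) D :=
  Submodule.span (Subring.center D)
    {x : D | ∃ (γ δ : Γ) (a b : D), a ∈ 𝒜 γ ∧ b ∈ 𝒜 δ ∧ x = a * b - b * a}

/-- The support of a subset `N` of a `Γ`-graded ring: the set of `γ` such that `N` contains
a nonzero element of degree `γ`. -/
def gradedSupport (𝒜 : Γ → AddSubgroup D) (N : Set D) : Set Γ :=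
  {γ : Γ | ∃ x ∈ N, x ∈ 𝒜 γ ∧ x ≠ 0}

open DirectSum in
/-- A homogeneous unit has a homogeneous inverse. -/
theorem exists_homogeneous_inverse (𝒜 : Γ → AddSubgroup D) [GradedRing 𝒜] {γ : Γ} {a : D}
    (ha : a ∈ 𝒜 γ) (hu : IsUnit a) : ∃ b ∈ 𝒜 (-γ), a * b = 1 ∧ b * a = 1 := by
  obtain ⟨v, hv, -⟩ := isUnit_iff_exists.mp hu
  have h : a * (decompose 𝒜 v (-γ) : D) = 1 := by
    rw [← coe_decompose_mul_add_of_left_mem 𝒜 ha, hv, add_neg_cancel,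
      decompose_of_mem_same 𝒜 SetLike.GradedOne.one_mem]
  exact ⟨_, SetLike.coe_mem _, h, hu.mul_left_cancel (by rw [← mul_assoc, h, one_mul, mul_one])⟩

open DirectSum in
/-- An element commuting with all homogeneous elements is central. -/
theorem mem_center_of_commute_homogeneous (𝒜 : Γ → AddSubgroup D) [GradedRing 𝒜] {x : D}
    (h : ∀ γ, ∀ y ∈ 𝒜 γ, y * x = x * y) : x ∈ Subring.center D := by
  rw [Subring.mem_center_iff]
  intro y
  induction y using Decomposition.inductionOn 𝒜 with
  | zero => simp
  | homogeneous y => exact h _ _ y.2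
  | add y z hy hz => rw [add_mul, mul_add, hy, hz]

theorem commutator_mem_homCommutatorSubmodule {ι : Type*} (𝒜 : ι → AddSubgroup D) {γ δ : ι}
    {a b : D} (ha : a ∈ 𝒜 γ) (hb : b ∈ 𝒜 δ) : a * b - b * a ∈ homCommutatorSubmodule 𝒜 :=
  Submodule.subset_span ⟨γ, δ, a, b, ha, hb, rfl⟩

/-- Homogeneous elements of opposite degrees commute if all elements of degree `0` are central. -/
theorem mul_comm_of_opposite_degrees (𝒜 : Γ → AddSubgroup D) [GradedRing 𝒜]
    (hdiv : ∀ (γ : Γ) (x : D), x ∈ 𝒜 γ → x ≠ 0 → IsUnit x)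
    (hcenter : ∀ x ∈ 𝒜 (0 : Γ), x ∈ Subring.center D) {γ : Γ} {a b : D}
    (ha : a ∈ 𝒜 (-γ)) (hb : b ∈ 𝒜 γ) : a * b = b * a := by
  rcases eq_or_ne b 0 with rfl | hb0
  · simp
  have hab : a * b ∈ 𝒜 (0 : Γ) := by simpa using SetLike.GradedMul.mul_mem ha hb
  apply (hdiv γ b hb hb0).mul_right_cancel
  rw [← Subring.mem_center_iff.mp (hcenter _ hab) b, mul_assoc]

open DirectSum in
/-- If all elements of degree `0` are central, then every element of `[D,D]` has zero component
in degree `0`. -/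
theorem decompose_zero_of_mem_homCommutatorSubmodule (𝒜 : Γ → AddSubgroup D) [GradedRing 𝒜]
    (hdiv : ∀ (γ : Γ) (x : D), x ∈ 𝒜 γ → x ≠ 0 → IsUnit x)
    (hcenter : ∀ x ∈ 𝒜 (0 : Γ), x ∈ Subring.center D) {x : D}
    (hx : x ∈ homCommutatorSubmodule 𝒜) : (decompose 𝒜 x 0 : D) = 0 := by
  induction hx using Submodule.closure_induction with
  | zero => simp
  | add x y _ _ hx hy => simp [hx, hy]
  | smul_mem c x hx =>
    obtain ⟨γ, δ, a, b, -, hb, rfl⟩ := hx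
    have hc : c • (a * b - b * a) = (c * a) * b - b * (c * a) := by
      rw [Subring.smul_def, smul_eq_mul, mul_sub, ← mul_assoc, ← mul_assoc, ← mul_assoc,
        Subring.mem_center_iff.mp c.2 b]
    have hl := coe_decompose_mul_add_of_right_mem 𝒜 (a := (c * a : D)) (i := -δ) hb
    have hr := coe_decompose_mul_add_of_left_mem 𝒜 (b := (c * a : D)) (j := -δ) hb
    rw [neg_add_cancel] at hl
    rw [add_neg_cancel] at hr
    rw [hc, decompose_sub, DirectSum.sub_apply, AddSubgroup.coe_sub, hl, hr, sub_eq_zero]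
    exact mul_comm_of_opposite_degrees 𝒜 hdiv hcenter (SetLike.coe_mem _) hb

/-- If `[D,D]` has no nonzero element in some degree of the support of `D`, then all elements of
degree `0` are central. -/
theorem mem_center_of_notMem_gradedSupport (𝒜 : Γ → AddSubgroup D) [GradedRing 𝒜]
    (hdiv : ∀ (γ : Γ) (x : D), x ∈ 𝒜 γ → x ≠ 0 → IsUnit x) {γ : Γ} {d : D}
    (hd : d ∈ 𝒜 γ) (hd0 : d ≠ 0)
    (hγ : γ ∉ gradedSupport 𝒜 (homCommutatorSubmodule 𝒜 : Set D)) {l : D}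
    (hl : l ∈ 𝒜 (0 : Γ)) : l ∈ Subring.center D := by
  refine mem_center_of_commute_homogeneous 𝒜 fun δ e he => ?_
  rcases eq_or_ne e 0 with rfl | he0
  · simp
  obtain ⟨f, hf, hef, hfe⟩ := exists_homogeneous_inverse 𝒜 he (hdiv δ e he he0)
  have key (k : D) (hk : k ∈ 𝒜 (0 : Γ)) : e * (k * f * d) = k * f * d * e := by
    have hy : k * f * d ∈ 𝒜 (0 + -δ + γ) :=
      SetLike.GradedMul.mul_mem (SetLike.GradedMul.mul_mem hk hf) hd
    have h₁ : e * (k * f * d) ∈ 𝒜 γ := by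
      have := SetLike.GradedMul.mul_mem he hy
      rwa [show δ + (0 + -δ + γ) = γ by abel] at this
    have h₂ : k * f * d * e ∈ 𝒜 γ := by
      have := SetLike.GradedMul.mul_mem hy he
      rwa [show 0 + -δ + γ + δ = γ by abel] at this
    by_contra hne
    exact hγ ⟨_, commutator_mem_homCommutatorSubmodule 𝒜 he hy, sub_mem h₁ h₂, sub_ne_zero.mpr hne⟩
  have hd_eq : d = f * d * e := by
    simpa [← mul_assoc, hef] using key 1 SetLike.GradedOne.one_mem
  have h : e * l * f = l := (hdiv γ d hd hd0).mul_right_cancel <| by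
    calc e * l * f * d = l * (f * d * e) := by simpa only [mul_assoc] using key l hl
      _ = l * d := by rw [← hd_eq]
  calc e * l = e * l * f * e := by rw [mul_assoc _ f, hfe, mul_one]
    _ = l * e := by rw [h]

/-- Let `D` be a graded division algebra (graded by an abelian group `Γ`) over its centre,
and let `[D,D]` be the submodule over the centre generated by the homogeneous additive
commutators.  Then: (1) if `D` is totally ramified (`D₀ = F₀`, i.e. every homogeneous element
of degree `0` is central) then `0 ∉ Supp([D,D])`; in particular, if moreover `D` is
noncommutative, `∅ ≠ Supp([D,D]) ⊊ Supp(D)`; and (2) if `D` is not totally ramified then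
`Supp([D,D]) = Supp(D)`. -/
theorem support_homCommutatorSubmodule
    (𝒜 : Γ → AddSubgroup D) [GradedRing 𝒜]
    (hdiv : ∀ (γ : Γ) (x : D), x ∈ 𝒜 γ → x ≠ 0 → IsUnit x)
    [Module.Finite (Subring.center D) D] :
    ((∀ x ∈ 𝒜 (0 : Γ), x ∈ Subring.center D) →
      (0 : Γ) ∉ gradedSupport 𝒜 (homCommutatorSubmodule 𝒜 : Set D) ∧
        ((∃ x y : D, x * y ≠ y * x) →
          (gradedSupport 𝒜 (homCommutatorSubmodule 𝒜 : Set D)).Nonempty ∧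
            gradedSupport 𝒜 (homCommutatorSubmodule 𝒜 : Set D) ⊂
              gradedSupport 𝒜 (Set.univ : Set D))) ∧
    ((∃ x ∈ 𝒜 (0 : Γ), x ∉ Subring.center D) →
      gradedSupport 𝒜 (homCommutatorSubmodule 𝒜 : Set D) =
        gradedSupport 𝒜 (Set.univ : Set D)) := by
  refine ⟨fun hcenter => ?_, fun ⟨l, hl, hlc⟩ => ?_⟩
  · have h0 : (0 : Γ) ∉ gradedSupport 𝒜 (homCommutatorSubmodule 𝒜 : Set D) := by
      rintro ⟨x, hx, hx0, hne⟩
      apply hne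
      rw [← DirectSum.decompose_of_mem_same 𝒜 hx0]
      exact decompose_zero_of_mem_homCommutatorSubmodule 𝒜 hdiv hcenter hx
    refine ⟨h0, fun ⟨x, y, hxy⟩ => ⟨?_, ?_⟩⟩
    · by_contra hempty
      rw [Set.not_nonempty_iff_eq_empty] at hempty
      refine hxy (Subring.mem_center_iff.mp (mem_center_of_commute_homogeneous 𝒜 ?_) x)
      intro γ a ha
      refine (Subring.mem_center_iff.mp (mem_center_of_commute_homogeneous 𝒜 ?_) y).symm
      intro δ b hb
      by_contra hne
      have hmem : γ + δ ∈ gradedSupport 𝒜 (homCommutatorSubmodule 𝒜 : Set D) :=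
        ⟨_, commutator_mem_homCommutatorSubmodule 𝒜 ha hb,
          sub_mem (SetLike.GradedMul.mul_mem ha hb)
            (add_comm γ δ ▸ SetLike.GradedMul.mul_mem hb ha), sub_ne_zero.mpr (Ne.symm hne)⟩
      rw [hempty] at hmem
      exact hmem
    · refine Set.ssubset_iff_exists.mpr
        ⟨fun γ ⟨z, _, hz⟩ => ⟨z, Set.mem_univ z, hz⟩, 0, ⟨1, Set.mem_univ _,
          SetLike.GradedOne.one_mem, fun h => hxy ?_⟩, h0⟩
      exact (subsingleton_of_zero_eq_one h.symm).elim _ _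
  · refine Set.Subset.antisymm (fun γ ⟨z, _, hz⟩ => ⟨z, Set.mem_univ z, hz⟩) ?_
    rintro γ ⟨d, -, hd, hd0⟩
    by_contra hγ
    exact hlc (mem_center_of_notMem_gradedSupport 𝒜 hdiv hd hd0 hγ hl)
end

section
/- Let Γ be a torsion-free abelian group (every nonzero element has infinite order) and let D be a nontrivial Γ-graded division ring. Then D has no zero divisors: for a, b ∈ D, if a·b = 0 then a = 0 or b = 0. Moreover the group of units of D consists exactly of the nonzero homogeneous elements. -/
open Finset in
/-- A torsion-free cancellative commutative monoid has two unique sums, because each of its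
finitely generated submonoids does. -/
theorem IsAddTorsionFree.to_twoUniqueSums (M : Type*) [AddCancelCommMonoid M]
    [IsAddTorsionFree M] : TwoUniqueSums M where
  uniqueAdd_of_one_lt_card {A B} hc := by
    classical
    let N := AddSubmonoid.closure ((A ∪ B : Finset M) : Set M)
    have : AddMonoid.FG N := (AddMonoid.fg_iff_addSubmonoid_fg N).2 ⟨A ∪ B, rfl⟩
    let : AddCancelCommMonoid N := Subtype.val_injective.addCancelCommMonoid _ rfl
      (fun _ _ => rfl) fun _ _ => rfl
    have : IsAddTorsionFree N :=
      ⟨fun n hn x y h => Subtype.ext <|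
        nsmul_right_injective hn (by simpa using congrArg Subtype.val h)⟩
    have hA : ∀ x ∈ A, x ∈ N := fun x hx => AddSubmonoid.subset_closure (by simp [hx])
    have hB : ∀ x ∈ B, x ∈ N := fun x hx => AddSubmonoid.subset_closure (by simp [hx])
    have hcard : 1 < #(A.subtype (· ∈ N)) * #(B.subtype (· ∈ N)) := by
      rwa [card_subtype, card_subtype, filter_true_of_mem hA, filter_true_of_mem hB]
    have lift : ∀ p : N × N, UniqueAdd (A.subtype (· ∈ N)) (B.subtype (· ∈ N)) p.1 p.2 →
        UniqueAdd A B (p.1 : M) p.2 := fun p hp x y hx hy h => by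
      have := @hp ⟨x, hA x hx⟩ ⟨y, hB y hy⟩ (by simpa using hx) (by simpa using hy)
        (Subtype.ext h)
      exact ⟨congrArg Subtype.val this.1, congrArg Subtype.val this.2⟩
    obtain ⟨p, hp, q, hq, hne, hup, huq⟩ := TwoUniqueSums.uniqueAdd_of_one_lt_card hcard
    refine ⟨(p.1, p.2), by simpa using hp, (q.1, q.2), by simpa using hq, fun h => hne ?_,
      lift p hup, lift q huq⟩
    exact Prod.ext (Subtype.ext (congrArg Prod.fst h)) (Subtype.ext (congrArg Prod.snd h))

namespace GradedRing

variable {Γ D σ : Type*} [AddMonoid Γ] [DecidableEq Γ] [Ring D] [SetLike σ D]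
  [AddSubgroupClass σ D] (𝒜 : Γ → σ) [GradedRing 𝒜]

open DirectSum

theorem mem_support_decompose [∀ (i : Γ) (x : 𝒜 i), Decidable (x ≠ 0)] {a : D} {i : Γ} :
    i ∈ (decompose 𝒜 a).support ↔ (decompose 𝒜 a i : D) ≠ 0 := by
  rw [DFinsupp.mem_support_toFun, Ne, Ne, ZeroMemClass.coe_eq_zero]

theorem support_decompose_nonempty [∀ (i : Γ) (x : 𝒜 i), Decidable (x ≠ 0)] {a : D}
    (ha : a ≠ 0) : (decompose 𝒜 a).support.Nonempty := by
  rwa [Finset.nonempty_iff_ne_empty, Ne, DFinsupp.support_eq_empty, ← decompose_zero 𝒜,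
    (decompose 𝒜).injective.eq_iff]

theorem coe_decompose_mul_of_uniqueAdd [∀ (i : Γ) (x : 𝒜 i), Decidable (x ≠ 0)] {a b : D}
    {i j : Γ} (hi : i ∈ (decompose 𝒜 a).support) (hj : j ∈ (decompose 𝒜 b).support)
    (h : UniqueAdd (decompose 𝒜 a).support (decompose 𝒜 b).support i j) :
    (decompose 𝒜 (a * b) (i + j) : D) = decompose 𝒜 a i * decompose 𝒜 b j := by
  rw [decompose_mul, coe_mul_apply, Finset.sum_eq_single (i, j)]
  · rintro ⟨k, l⟩ hkl hne
    simp only [Finset.mem_filter, Finset.mem_product] at hkl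
    exact absurd (Prod.ext_iff.2 (h hkl.1.1 hkl.1.2 hkl.2)) hne
  · intro hij
    exact absurd (by simp only [Finset.mem_filter, Finset.mem_product, hi, hj, and_self]) hij

/-- If nonzero homogeneous elements are units, the leading terms of a product at a unique sum
of degrees do not cancel. -/
theorem coe_decompose_mul_ne_zero_of_uniqueAdd [∀ (i : Γ) (x : 𝒜 i), Decidable (x ≠ 0)]
    (hdiv : ∀ (γ : Γ) (x : D), x ∈ 𝒜 γ → x ≠ 0 → IsUnit x) {a b : D}
    {i j : Γ} (hi : i ∈ (decompose 𝒜 a).support) (hj : j ∈ (decompose 𝒜 b).support)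
    (h : UniqueAdd (decompose 𝒜 a).support (decompose 𝒜 b).support i j) :
    (decompose 𝒜 (a * b) (i + j) : D) ≠ 0 := by
  rw [coe_decompose_mul_of_uniqueAdd 𝒜 hi hj h, Ne,
    (hdiv i _ (decompose 𝒜 a i).2 ((mem_support_decompose 𝒜).1 hi)).mul_right_eq_zero]
  exact (mem_support_decompose 𝒜).1 hj

theorem mul_ne_zero_of_uniqueSums [UniqueSums Γ]
    (hdiv : ∀ (γ : Γ) (x : D), x ∈ 𝒜 γ → x ≠ 0 → IsUnit x) {a b : D} (ha : a ≠ 0)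
    (hb : b ≠ 0) : a * b ≠ 0 := by
  classical
  obtain ⟨i, hi, j, hj, h⟩ := UniqueSums.uniqueAdd_of_nonempty
    (support_decompose_nonempty 𝒜 ha) (support_decompose_nonempty 𝒜 hb)
  intro hab
  apply coe_decompose_mul_ne_zero_of_uniqueAdd 𝒜 hdiv hi hj h
  rw [hab, decompose_zero, DirectSum.zero_apply, ZeroMemClass.coe_zero]

/-- If nonzero homogeneous elements are units and the degrees have two unique sums, then the
factors of a nonzero homogeneous product are homogeneous. -/
theorem exists_mem_of_mul_mem [TwoUniqueSums Γ]
    (hdiv : ∀ (γ : Γ) (x : D), x ∈ 𝒜 γ → x ≠ 0 → IsUnit x) {a b : D} {γ : Γ}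
    (hab : a * b ∈ 𝒜 γ) (h0 : a * b ≠ 0) : ∃ δ, a ∈ 𝒜 δ := by
  classical
  have ha := support_decompose_nonempty 𝒜 (left_ne_zero_of_mul h0)
  have hb := support_decompose_nonempty 𝒜 (right_ne_zero_of_mul h0)
  have hsum : ∀ p ∈ (decompose 𝒜 a).support ×ˢ (decompose 𝒜 b).support,
      UniqueAdd (decompose 𝒜 a).support (decompose 𝒜 b).support p.1 p.2 → p.1 + p.2 = γ := by
    intro p hp hu
    rw [Finset.mem_product] at hp
    by_contra hne
    exact coe_decompose_mul_ne_zero_of_uniqueAdd 𝒜 hdiv hp.1 hp.2 hu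
      (decompose_of_mem_ne 𝒜 hab (Ne.symm hne))
  have hcard : (decompose 𝒜 a).support.card ≤ 1 := by
    by_contra! hlt
    obtain ⟨p, hp, q, hq, hne, hup, huq⟩ := TwoUniqueSums.uniqueAdd_of_one_lt_card
      (lt_of_lt_of_le hlt (Nat.le_mul_of_pos_right _ hb.card_pos))
    have hp' := Finset.mem_product.1 hp
    exact hne (Prod.ext_iff.2 (huq hp'.1 hp'.2 ((hsum p hp hup).trans (hsum q hq huq).symm)))
  obtain ⟨δ, hδ⟩ := Finset.card_eq_one.1 (le_antisymm hcard ha.card_pos)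
  refine ⟨δ, ?_⟩
  rw [← sum_support_decompose 𝒜 a, hδ, Finset.sum_singleton]
  exact (decompose 𝒜 a δ).2

end GradedRing

/-- Let `Γ` be a torsion-free abelian group and `D` a nontrivial `Γ`-graded division ring
(every nonzero homogeneous element is invertible).  Then `D` has no zero divisors, and the
units of `D` are exactly the nonzero homogeneous elements. -/
theorem gradedDivisionRing_torsionFree_noZeroDivisors
    (Γ D : Type*) [AddCommGroup Γ] [DecidableEq Γ] [Ring D] [Nontrivial D]
    (𝒜 : Γ → AddSubgroup D) [GradedRing 𝒜]
    (htf : ∀ γ : Γ, γ ≠ 0 → ∀ n : ℕ, n ≠ 0 → n • γ ≠ 0)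
    (hdiv : ∀ (γ : Γ) (x : D), x ∈ 𝒜 γ → x ≠ 0 → IsUnit x) :
    (∀ a b : D, a * b = 0 → a = 0 ∨ b = 0) ∧
    (∀ a : D, IsUnit a ↔ a ≠ 0 ∧ ∃ γ, a ∈ 𝒜 γ) := by
  have : IsAddTorsionFree Γ := IsAddTorsionFree.of_not_isOfFinAddOrder fun γ hγ h => by
    obtain ⟨n, hn, h0⟩ := isOfFinAddOrder_iff_nsmul_eq_zero.1 h
    exact htf γ hγ n hn.ne' h0
  have : TwoUniqueSums Γ := IsAddTorsionFree.to_twoUniqueSums Γ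
  refine ⟨fun a b hab => ?_, fun a => ⟨fun ha => ⟨ha.ne_zero, ?_⟩, ?_⟩⟩
  · by_contra! h
    exact GradedRing.mul_ne_zero_of_uniqueSums 𝒜 hdiv h.1 h.2 hab
  · obtain ⟨b, hab⟩ := ha.exists_right_inv
    exact GradedRing.exists_mem_of_mul_mem 𝒜 hdiv (hab ▸ SetLike.GradedOne.one_mem)
      (hab ▸ one_ne_zero)
  · rintro ⟨h0, γ, hγ⟩
    exact hdiv γ a hγ h0
end

section
/- Let Γ be a torsion-free abelian group and let D be a graded division algebra, graded by Γ, over its centre F, and assume F is Noetherian as a ring. Then F is an integral domain; let QF denote its field of fractions and QD = QF ⊗_F D the quotient division ring of D, into which D embeds via d ↦ 1 ⊗ d. Let [D,D] denote the F-submodule of D spanned by all additive commutators ab − ba with a, b ∈ D (equivalently, by the homogeneous additive commutators), and [QD,QD] the QF-subspace of QD spanned by all additive commutators of QD. Then [D,D] = [QD,QD] ∩ D: for every d ∈ D, d ∈ [D,D] if and only if 1 ⊗ d ∈ [QD,QD]. -/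
open TensorProduct

set_option synthInstance.maxHeartbeats 1000000
set_option maxHeartbeats 1000000

/-- A torsion-free abelian group embeds in a rational vector space, so it has unique sums. -/
theorem uniqueSums_of_torsionFree {Γ : Type*} [AddCommGroup Γ]
    (htf : ∀ γ : Γ, γ ≠ 0 → ∀ n : ℕ, n ≠ 0 → n • γ ≠ 0) : UniqueSums Γ := by
  have : IsAddTorsionFree Γ := by
    refine ⟨fun n hn a b hab => ?_⟩
    by_contra hne
    refine htf (a - b) (sub_ne_zero.mpr hne) n hn ?_
    rw [nsmul_sub, sub_eq_zero]
    exact hab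
  exact UniqueSums.of_injective_addHom
    ((DivisibleHull.coeAddMonoidHom Γ : Γ →+ DivisibleHull Γ) : Γ →ₙ+ DivisibleHull Γ)
    DivisibleHull.coe_injective inferInstance

section GradedRing

variable {Γ D : Type*} [AddCommGroup Γ] [DecidableEq Γ] [Ring D]
  (𝒜 : Γ → AddSubgroup D) [GradedRing 𝒜]

/-- If `γ + δ` is attained only once as a sum of degrees of `a` and `b`, the component of `a * b`
in that degree is the product of the corresponding components. -/
theorem decompose_mul_of_uniqueAdd [∀ (i : Γ) (x : 𝒜 i), Decidable (x ≠ 0)] {a b : D} {γ δ : Γ}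
    (h : UniqueAdd (DirectSum.decompose 𝒜 a).support (DirectSum.decompose 𝒜 b).support γ δ)
    (hγ : γ ∈ (DirectSum.decompose 𝒜 a).support) (hδ : δ ∈ (DirectSum.decompose 𝒜 b).support) :
    (DirectSum.decompose 𝒜 (a * b) (γ + δ) : D) =
      (DirectSum.decompose 𝒜 a γ : D) * (DirectSum.decompose 𝒜 b δ : D) := by
  rw [DirectSum.decompose_mul, DirectSum.coe_mul_apply]
  refine Finset.sum_eq_single_of_mem (γ, δ)
    (Finset.mem_filter.mpr ⟨Finset.mem_product.mpr ⟨hγ, hδ⟩, rfl⟩) ?_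
  rintro ⟨i, j⟩ hij hne
  simp only [Finset.mem_filter, Finset.mem_product] at hij
  obtain ⟨rfl, rfl⟩ := h hij.1.1 hij.1.2 hij.2
  exact absurd rfl hne

/-- The homogeneous components of a central element are central. -/
theorem decompose_mem_center {z : D} (hz : z ∈ Subring.center D) (γ : Γ) :
    (DirectSum.decompose 𝒜 z γ : D) ∈ Subring.center D := by
  rw [Subring.mem_center_iff] at hz ⊢
  intro g
  induction g using DirectSum.Decomposition.inductionOn 𝒜 with
  | zero => simp
  | @homogeneous δ m =>
    rw [← DirectSum.coe_decompose_mul_add_of_left_mem 𝒜 m.2,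
      ← DirectSum.coe_decompose_mul_add_of_right_mem 𝒜 m.2, hz, add_comm]
  | add m m' hm hm' => rw [add_mul, mul_add, hm, hm']

/-- The submodule spanned over the centre by the additive commutators is homogeneous. -/
theorem isHomogeneous_span_commutators :
    DirectSum.SetLike.IsHomogeneous 𝒜
      (Submodule.span (Subring.center D) {x : D | ∃ a b : D, x = a * b - b * a}) := by
  intro i m hm
  induction hm using Submodule.closure_induction with
  | zero => simp
  | add x y _ _ hx hy =>
    rw [DirectSum.decompose_add, DirectSum.add_apply, AddSubgroup.coe_add]
    exact add_mem hx hy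
  | smul_mem r x hx =>
    obtain ⟨a, b, rfl⟩ := hx
    have hr : r • (a * b - b * a) = (r • a) * b - b * (r • a) := by
      rw [smul_mul_assoc, mul_smul_comm, smul_sub]
    rw [hr]
    clear hr
    generalize r • a = a
    induction a using DirectSum.Decomposition.inductionOn 𝒜 with
    | zero => simp
    | add a a' ha ha' =>
      rw [show (a + a') * b - b * (a + a') = (a * b - b * a) + (a' * b - b * a') by
          rw [add_mul, mul_add]; abel,
        DirectSum.decompose_add, DirectSum.add_apply, AddSubgroup.coe_add]
      exact add_mem ha ha'
    | @homogeneous γ a =>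
      induction b using DirectSum.Decomposition.inductionOn 𝒜 with
      | zero => simp
      | add b b' hb hb' =>
        rw [show (a : D) * (b + b') - (b + b') * a = (a * b - b * a) + (a * b' - b' * a) by
            rw [add_mul, mul_add]; abel,
          DirectSum.decompose_add, DirectSum.add_apply, AddSubgroup.coe_add]
        exact add_mem hb hb'
      | @homogeneous δ b =>
        have hmem : (a : D) * b - b * a ∈ 𝒜 (γ + δ) :=
          sub_mem (SetLike.mul_mem_graded a.2 b.2)
            (add_comm δ γ ▸ SetLike.mul_mem_graded b.2 a.2)
        by_cases h : γ + δ = i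
        · subst h
          rw [DirectSum.decompose_of_mem_same 𝒜 hmem]
          exact Submodule.subset_span ⟨a, b, rfl⟩
        · rw [DirectSum.decompose_of_mem_ne 𝒜 hmem h]
          exact zero_mem _

/-- The quotient of a graded division ring by a homogeneous submodule over its centre is
torsion-free when the grading group has unique sums. -/
theorem mem_of_center_smul_mem [UniqueSums Γ]
    (hdiv : ∀ (γ : Γ) (x : D), x ∈ 𝒜 γ → x ≠ 0 → IsUnit x)
    {C : Submodule (Subring.center D) D} (hC : DirectSum.SetLike.IsHomogeneous 𝒜 C)
    {f : Subring.center D} (hf : f ≠ 0) {x : D} (hx : f • x ∈ C) : x ∈ C := by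
  classical
  induction hn : (DirectSum.decompose 𝒜 x).support.card using Nat.strong_induction_on
    generalizing x with
  | _ n ih =>
  by_cases hx0 : x = 0
  · rw [hx0]
    exact zero_mem C
  have support_nonempty : ∀ y : D, y ≠ 0 → (DirectSum.decompose 𝒜 y).support.Nonempty := by
    intro y hy
    rw [Finset.nonempty_iff_ne_empty, Ne, DFinsupp.support_eq_empty]
    exact fun h => hy ((DirectSum.decompose 𝒜).injective (by rw [h, DirectSum.decompose_zero]))
  obtain ⟨γ, hγ, δ, hδ, hu⟩ := UniqueSums.uniqueAdd_of_nonempty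
    (support_nonempty (f : D) (by simpa using hf)) (support_nonempty x hx0)
  have hcomp := hC (γ + δ) hx
  rw [show f • x = (f : D) * x from rfl, decompose_mul_of_uniqueAdd 𝒜 hu hγ hδ] at hcomp
  obtain ⟨u, hu'⟩ := hdiv γ _ (DirectSum.decompose 𝒜 (f : D) γ).2
    (by simpa using (DFinsupp.mem_support_iff.mp hγ))
  have hucenter : (u : D) ∈ Subring.center D := hu' ▸ decompose_mem_center 𝒜 f.2 γ
  have hinv : ((u⁻¹ : Dˣ) : D) ∈ Subring.center D := by
    rw [Subring.mem_center_iff] at hucenter ⊢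
    intro g
    rw [Units.eq_inv_mul_iff_mul_eq, ← mul_assoc, ← hucenter, mul_assoc, Units.mul_inv, mul_one]
  have hδC : (DirectSum.decompose 𝒜 x δ : D) ∈ C := by
    have := C.smul_mem ⟨_, hinv⟩ hcomp
    rwa [Subring.smul_def, smul_eq_mul, ← hu', Units.inv_mul_cancel_left] at this
  have hsub : x - (DirectSum.decompose 𝒜 x δ : D) ∈ C := by
    refine ih _ ?_ (x := x - (DirectSum.decompose 𝒜 x δ : D)) ?_ rfl
    · rw [← hn]
      refine Finset.card_lt_card ((Finset.ssubset_iff_of_subset ?_).mpr ⟨δ, hδ, ?_⟩)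
      · intro j hj
        rw [DFinsupp.mem_support_iff] at hj ⊢
        contrapose! hj
        rw [DirectSum.decompose_sub, DirectSum.sub_apply, DirectSum.decompose_coe, hj]
        by_cases h : δ = j
        · subst h
          rw [DirectSum.of_eq_same, hj, sub_zero]
        · rw [DirectSum.of_eq_of_ne _ _ _ (Ne.symm h), sub_zero]
      · rw [DFinsupp.notMem_support_iff, DirectSum.decompose_sub, DirectSum.sub_apply,
          DirectSum.decompose_coe, DirectSum.of_eq_same, sub_self]
    · rw [smul_sub]
      exact sub_mem hx (C.smul_mem f hδC)
  simpa using add_mem hsub hδC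

end GradedRing

/-- A linear combination of commutators in the base change of an algebra to a fraction ring becomes,
after clearing denominators, a linear combination of commutators of the algebra. -/
theorem exists_smul_eq_tmul_of_mem_span_commutators {F D : Type*} [CommRing F] [Ring D]
    [Algebra F D] {x : FractionRing F ⊗[F] D}
    (hx : x ∈ Submodule.span (FractionRing F)
      {x : FractionRing F ⊗[F] D | ∃ u v : FractionRing F ⊗[F] D, x = u * v - v * u}) :
    ∃ s ∈ nonZeroDivisors F, ∃ c ∈ Submodule.span F {x : D | ∃ a b : D, x = a * b - b * a},
      s • x = (1 : FractionRing F) ⊗ₜ[F] c := by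
  induction hx using Submodule.closure_induction with
  | zero => exact ⟨1, one_mem _, 0, zero_mem _, by simp⟩
  | add x y _ _ hx hy =>
    obtain ⟨s, hs, c, hc, hsc⟩ := hx
    obtain ⟨t, ht, d, hd, htd⟩ := hy
    refine ⟨s * t, mul_mem hs ht, t • c + s • d,
      add_mem (Submodule.smul_mem _ _ hc) (Submodule.smul_mem _ _ hd), ?_⟩
    rw [smul_add, TensorProduct.tmul_add, TensorProduct.tmul_smul, TensorProduct.tmul_smul, ← hsc,
      ← htd, smul_smul, smul_smul, mul_comm t s]
  | smul_mem r x hx =>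
    obtain ⟨u, v, rfl⟩ := hx
    have hr : r • (u * v - v * u) = (r • u) * v - v * (r • u) := by
      rw [smul_mul_assoc, mul_smul_comm, smul_sub]
    rw [hr]
    obtain ⟨⟨a, s⟩, ha⟩ := IsLocalizedModule.surj (nonZeroDivisors F)
      (TensorProduct.mk F (FractionRing F) D 1) (r • u)
    obtain ⟨⟨b, t⟩, hb⟩ := IsLocalizedModule.surj (nonZeroDivisors F)
      (TensorProduct.mk F (FractionRing F) D 1) v
    simp only [Submonoid.smul_def, TensorProduct.mk_apply] at ha hb
    refine ⟨s * t, mul_mem s.2 t.2, a * b - b * a, Submodule.subset_span ⟨a, b, rfl⟩, ?_⟩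
    have h₁ : ((s : F) * t) • ((r • u) * v) = ((s : F) • (r • u)) * ((t : F) • v) :=
      (smul_mul_smul_comm _ _ _ _).symm
    have h₂ : ((s : F) * t) • (v * (r • u)) = ((t : F) • v) * ((s : F) • (r • u)) := by
      rw [smul_mul_smul_comm, mul_comm]
    rw [smul_sub, h₁, h₂, ha, hb, TensorProduct.tmul_sub,
      Algebra.TensorProduct.tmul_mul_tmul, Algebra.TensorProduct.tmul_mul_tmul, one_mul]

/-- Let `Γ` be a torsion-free abelian group and `D` a graded division algebra over its centre
`F = Z(D)` (a graded division ring, finite-dimensional over its centre), with `F` Noetherian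
as a ring.  Then `F` is an integral domain, and with `QF` its field of fractions and
`QD = QF ⊗[F] D` the quotient division ring of `D` (into which `D` embeds via `d ↦ 1 ⊗ d`),
one has `[D,D] = [QD,QD] ∩ D`: an element `d ∈ D` lies in the `F`-submodule spanned by the
additive commutators of `D` if and only if `1 ⊗ d` lies in the `QF`-subspace of `QD` spanned
by the additive commutators of `QD`. -/
theorem commutatorSubmodule_eq_quotient_commutator_inter
    (Γ D : Type*) [AddCommGroup Γ] [DecidableEq Γ] [Ring D] [Nontrivial D]
    (𝒜 : Γ → AddSubgroup D) [GradedRing 𝒜]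
    (htf : ∀ γ : Γ, γ ≠ 0 → ∀ n : ℕ, n ≠ 0 → n • γ ≠ 0)
    (hdiv : ∀ (γ : Γ) (x : D), x ∈ 𝒜 γ → x ≠ 0 → IsUnit x)
    [Module.Finite (Subring.center D) D]
    [IsNoetherianRing (Subring.center D)] :
    IsDomain (Subring.center D) ∧
    ∀ d : D,
      d ∈ Submodule.span (Subring.center D) {x : D | ∃ a b : D, x = a * b - b * a} ↔
        ((1 : FractionRing (Subring.center D)) ⊗ₜ[Subring.center D] d :
            FractionRing (Subring.center D) ⊗[Subring.center D] D) ∈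
          Submodule.span (FractionRing (Subring.center D))
            {x : FractionRing (Subring.center D) ⊗[Subring.center D] D |
              ∃ u v : FractionRing (Subring.center D) ⊗[Subring.center D] D,
                x = u * v - v * u} := by
  have := uniqueSums_of_torsionFree htf
  refine ⟨?_, fun d => ⟨fun hd => ?_, fun hd => ?_⟩⟩
  · have : NoZeroDivisors (Subring.center D) := by
      refine ⟨fun {a b} hab => or_iff_not_imp_left.mpr fun ha => ?_⟩
      have hbot : DirectSum.SetLike.IsHomogeneous 𝒜 (⊥ : Submodule (Subring.center D) D) := by
        rintro i _ rfl
        simp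
      have hb := mem_of_center_smul_mem 𝒜 hdiv hbot ha (x := (b : D))
        ((Submodule.mem_bot _).mpr (congrArg Subtype.val hab))
      exact Subtype.ext ((Submodule.mem_bot _).mp hb)
    exact NoZeroDivisors.to_isDomain _
  · induction hd using Submodule.span_induction with
    | mem x hx =>
      obtain ⟨a, b, rfl⟩ := hx
      exact Submodule.subset_span ⟨1 ⊗ₜ a, 1 ⊗ₜ b, by
        rw [TensorProduct.tmul_sub, Algebra.TensorProduct.tmul_mul_tmul,
          Algebra.TensorProduct.tmul_mul_tmul, one_mul]⟩
    | zero =>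
      rw [TensorProduct.tmul_zero]
      exact zero_mem _
    | add x y _ _ hx hy =>
      rw [TensorProduct.tmul_add]
      exact add_mem hx hy
    | smul r x _ hx =>
      rw [TensorProduct.tmul_smul]
      exact Submodule.smul_of_tower_mem _ r hx
  · obtain ⟨s, hs, c, hc, hsc⟩ := exists_smul_eq_tmul_of_mem_span_commutators hd
    rw [← TensorProduct.tmul_smul] at hsc
    obtain ⟨t, ht⟩ := (IsLocalizedModule.eq_iff_exists (nonZeroDivisors (Subring.center D))
      (TensorProduct.mk (Subring.center D) (FractionRing (Subring.center D)) D 1)).mp hsc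
    have hC := isHomogeneous_span_commutators 𝒜
    refine mem_of_center_smul_mem 𝒜 hdiv hC (nonZeroDivisors.ne_zero hs)
      (mem_of_center_smul_mem 𝒜 hdiv hC (nonZeroDivisors.ne_zero t.2) ?_)
    rw [← Submonoid.smul_def, ht]
    exact Submodule.smul_mem _ _ hc
end
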